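/- Suppose n ≥ 4. In H(e,e,n), if a_{n−1} = s_{n−1} s_{n−2} ⋯ sᵢ with 3 ≤ i ≤ n−1 and aₙ = sₙ s_{n−1} ⋯ s_{i'} with 3 ≤ i' ≤ n, then sₙ·(a_{n−1} aₙ) belongs to Span(Λ_{n−1} Λₙ). -/

import Mathlib

noncomputable section

open scoped Pointwise

/-- The base ring `R₀ = ℤ[a]`. -/
abbrev R0 : Type := Polynomial ℤ

/-- The variable `a ∈ R₀`. -/
def aP : R0 := Polynomial.X

/-- Generators of the Corran–Picantin presentation: `t_i` for `i ∈ ℤ/eℤ` and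
`s_j` for `3 ≤ j ≤ n`. -/
inductive HGen (e n : ℕ) : Type
  | t : ZMod e → HGen e n
  | s : (j : ℕ) → 3 ≤ j → j ≤ n → HGen e n

open FreeAlgebra

/-- The free `R₀`-algebra on the generators. -/
abbrev FA (e n : ℕ) : Type := FreeAlgebra R0 (HGen e n)

/-- The defining relations of the Hecke algebra `H(e,e,n)`. -/
inductive HRel (e n : ℕ) : FA e n → FA e n → Prop
  | tt (i j : ZMod e) :
      HRel e n (ι R0 (HGen.t i) * ι R0 (HGen.t (i - 1)))
               (ι R0 (HGen.t j) * ι R0 (HGen.t (j - 1)))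
  | tst (i : ZMod e) (h : 3 ≤ n) :
      HRel e n (ι R0 (HGen.t i) * ι R0 (HGen.s 3 le_rfl h) * ι R0 (HGen.t i))
               (ι R0 (HGen.s 3 le_rfl h) * ι R0 (HGen.t i) * ι R0 (HGen.s 3 le_rfl h))
  | st (i : ZMod e) (j : ℕ) (h3 : 3 ≤ j) (h4 : 4 ≤ j) (hn : j ≤ n) :
      HRel e n (ι R0 (HGen.s j h3 hn) * ι R0 (HGen.t i))
               (ι R0 (HGen.t i) * ι R0 (HGen.s j h3 hn))
  | braid (i : ℕ) (h3 : 3 ≤ i) (h3' : 3 ≤ i + 1) (hn' : i ≤ n) (hn : i + 1 ≤ n) :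
      HRel e n (ι R0 (HGen.s i h3 hn') * ι R0 (HGen.s (i + 1) h3' hn) * ι R0 (HGen.s i h3 hn'))
               (ι R0 (HGen.s (i + 1) h3' hn) * ι R0 (HGen.s i h3 hn') * ι R0 (HGen.s (i + 1) h3' hn))
  | comm (i j : ℕ) (h3i : 3 ≤ i) (hni : i ≤ n) (h3j : 3 ≤ j) (hnj : j ≤ n)
      (hij : i + 1 < j ∨ j + 1 < i) :
      HRel e n (ι R0 (HGen.s i h3i hni) * ι R0 (HGen.s j h3j hnj))
               (ι R0 (HGen.s j h3j hnj) * ι R0 (HGen.s i h3i hni))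
  | tq (i : ZMod e) :
      HRel e n (ι R0 (HGen.t i) * ι R0 (HGen.t i))
               (algebraMap R0 (FA e n) aP * ι R0 (HGen.t i) + 1)
  | sq (j : ℕ) (h3 : 3 ≤ j) (hn : j ≤ n) :
      HRel e n (ι R0 (HGen.s j h3 hn) * ι R0 (HGen.s j h3 hn))
               (algebraMap R0 (FA e n) aP * ι R0 (HGen.s j h3 hn) + 1)

/-- The Hecke algebra `H(e,e,n)`. -/
abbrev Hecke (e n : ℕ) : Type := RingQuot (HRel e n)

/-- The generator `t_i` of `H(e,e,n)`. -/
def tH (e n : ℕ) (i : ZMod e) : Hecke e n :=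
  RingQuot.mkAlgHom R0 (HRel e n) (ι R0 (HGen.t i))

/-- The generator `s_j` of `H(e,e,n)` (junk value `1` when `j` is out of range). -/
def sH (e n : ℕ) (j : ℕ) : Hecke e n :=
  if h : 3 ≤ j ∧ j ≤ n then RingQuot.mkAlgHom R0 (HRel e n) (ι R0 (HGen.s j h.1 h.2)) else 1

/-- Decreasing-index product `s_m s_{m-1} ⋯ s_{i'}` (empty when `m < i'`). -/
def sDescH (e n m i' : ℕ) : Hecke e n :=
  (((List.range' i' (m + 1 - i')).reverse).map (sH e n)).prod

/-- Increasing-index product `s_{i'} s_{i'+1} ⋯ s_m` (empty when `m < i'`). -/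
def sAscH (e n i' m : ℕ) : Hecke e n :=
  ((List.range' i' (m + 1 - i')).map (sH e n)).prod

/-- `Λ₂ = {1} ∪ {t_k : 0 ≤ k ≤ e-1} ∪ {t_k t₀ : 1 ≤ k ≤ e-1}` in `H(e,e,n)`. -/
def Lam2 (e n : ℕ) : Set (Hecke e n) :=
  {1} ∪ {x | ∃ k < e, x = tH e n (k : ZMod e)} ∪
    {x | ∃ k, 1 ≤ k ∧ k < e ∧ x = tH e n (k : ZMod e) * tH e n 0}

/-- `Λ_m = {1} ∪ {s_m ⋯ s_{i'} : 3 ≤ i' ≤ m} ∪ {s_m ⋯ s₃ t_k : 0 ≤ k ≤ e-1}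
∪ {s_m ⋯ s₃ t_k s₂ s₃ ⋯ s_{i'} : 1 ≤ k ≤ e-1, 2 ≤ i' ≤ m}` in `H(e,e,n)`,
where `s₂ = t₀`. -/
def LamH (e n m : ℕ) : Set (Hecke e n) :=
  {1} ∪ {x | ∃ i', 3 ≤ i' ∧ i' ≤ m ∧ x = sDescH e n m i'} ∪
    {x | ∃ k < e, x = sDescH e n m 3 * tH e n (k : ZMod e)} ∪
    {x | ∃ k, 1 ≤ k ∧ k < e ∧ ∃ i', 2 ≤ i' ∧ i' ≤ m ∧
      x = sDescH e n m 3 * tH e n (k : ZMod e) * tH e n 0 * sAscH e n 3 i'}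


theorem sH_braid (e n k : ℕ) (h3 : 3 ≤ k) (hn : k + 1 ≤ n) :
    sH e n k * sH e n (k+1) * sH e n k = sH e n (k+1) * sH e n k * sH e n (k+1) := by
  have h1 : 3 ≤ k ∧ k ≤ n := ⟨h3, by omega⟩
  have h2 : 3 ≤ k + 1 ∧ k + 1 ≤ n := ⟨by omega, hn⟩
  have := RingQuot.mkAlgHom_rel R0 (HRel.braid (e := e) (n := n) k h3 h2.1 h1.2 hn)
  simpa only [sH, dif_pos h1, dif_pos h2, map_mul] using this

theorem sH_comm (e n i j : ℕ) (hij : i + 1 < j ∨ j + 1 < i) :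
    Commute (sH e n i) (sH e n j) := by
  by_cases h1 : 3 ≤ i ∧ i ≤ n
  · by_cases h2 : 3 ≤ j ∧ j ≤ n
    · have := RingQuot.mkAlgHom_rel R0
        (HRel.comm (e := e) (n := n) i j h1.1 h1.2 h2.1 h2.2 hij)
      unfold Commute SemiconjBy
      simpa only [sH, dif_pos h1, dif_pos h2, map_mul] using this
    · simp [sH, dif_neg h2]
  · simp [sH, dif_neg h1]

theorem sH_sq (e n j : ℕ) (h3 : 3 ≤ j) (hn : j ≤ n) :
    sH e n j * sH e n j = aP • sH e n j + 1 := by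
  have h1 : 3 ≤ j ∧ j ≤ n := ⟨h3, hn⟩
  have := RingQuot.mkAlgHom_rel R0 (HRel.sq (e := e) (n := n) j h3 hn)
  rw [Algebra.smul_def]
  simpa only [sH, dif_pos h1, map_mul, map_add, map_one, AlgHom.commutes] using this

theorem sDescH_split (e n m i j : ℕ) (h1 : i ≤ j + 1) (h2 : j ≤ m) :
    sDescH e n m i = sDescH e n m (j+1) * sDescH e n j i := by
  unfold sDescH
  rw [← List.prod_append, ← List.map_append, ← List.reverse_append]
  have h : i + 1 * (j + 1 - i) = j + 1 := by omega
  have := @List.range'_append i (j + 1 - i) (m + 1 - (j + 1)) 1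
  rw [h] at this
  rw [this]
  congr 4
  omega

theorem sDescH_self (e n m : ℕ) : sDescH e n m m = sH e n m := by
  simp [sDescH]

theorem sDescH_empty (e n m i : ℕ) (h : m < i) : sDescH e n m i = 1 := by
  have : m + 1 - i = 0 := by omega
  simp [sDescH, this]

theorem sDescH_succ (e n m i : ℕ) (h : i ≤ m + 1) :
    sDescH e n (m+1) i = sH e n (m+1) * sDescH e n m i := by
  rw [sDescH_split e n (m+1) i m h (by omega), sDescH_self]

theorem comm_sDescH (e n m i : ℕ) (x : Hecke e n)
    (h : ∀ j, i ≤ j → j ≤ m → Commute x (sH e n j)) : Commute x (sDescH e n m i) := by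
  unfold sDescH
  apply Commute.list_prod_right
  intro y hy
  simp only [List.mem_map, List.mem_reverse, List.mem_range'_1] at hy
  obtain ⟨j, hj, rfl⟩ := hy
  exact h j (by omega) (by omega)

theorem sDescH_shift (e n m i k : ℕ) (h3 : 3 ≤ i) (hik : i ≤ k) (hkm : k + 1 ≤ m) (hm : m ≤ n) :
    sDescH e n m i * sH e n (k+1) = sH e n k * sDescH e n m i := by
  induction m, hkm using Nat.le_induction with
  | base =>
    obtain ⟨l, rfl⟩ : ∃ l, k = l + 1 := ⟨k - 1, by omega⟩
    have hc : Commute (sH e n (l+1+1)) (sDescH e n l i) :=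
      comm_sDescH _ _ _ _ _ fun j _ _ => sH_comm _ _ _ _ (by omega)
    rw [sDescH_succ e n (l+1) i (by omega), sDescH_succ e n l i hik]
    simp only [mul_assoc]
    rw [← hc.eq]
    simp only [← mul_assoc]
    rw [sH_braid e n (l+1) (by omega) hm]
  | succ m hkm ih =>
    rw [sDescH_succ e n m i (by omega), mul_assoc, ih (by omega), ← mul_assoc, ← mul_assoc,
      (sH_comm e n (m+1) k (by omega)).eq]

theorem sDescH_shift_prod (e n m i k l : ℕ) (h3 : 3 ≤ i) (hik : i ≤ k) (hkl : k ≤ l)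
    (hlm : l + 1 ≤ m) (hm : m ≤ n) :
    sDescH e n m i * sDescH e n (l+1) (k+1) = sDescH e n l k * sDescH e n m i := by
  induction l, hkl using Nat.le_induction with
  | base => rw [sDescH_self, sDescH_self, sDescH_shift e n m i k h3 hik hlm hm]
  | succ l hkl ih =>
    rw [sDescH_succ e n (l+1) (k+1) (by omega), sDescH_succ e n l k (by omega), ← mul_assoc,
      sDescH_shift e n m i (l+1) h3 (by omega) hlm hm, mul_assoc, ih (by omega), mul_assoc]

theorem desc_mul_mem (e n p i j : ℕ) (h3i : 3 ≤ i) (hi : i ≤ p) (h3j : 3 ≤ j) (hj : j ≤ p + 1) :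
    sDescH e n p i * sDescH e n (p+1) j ∈
      Submodule.span R0 (LamH e n p * LamH e n (p+1)) := by
  apply Submodule.subset_span
  apply Set.mul_mem_mul
  · exact Or.inl (Or.inl (Or.inr ⟨i, h3i, hi, rfl⟩))
  · exact Or.inl (Or.inl (Or.inr ⟨j, h3j, hj, rfl⟩))

/-- For `n ≥ 4`, `a_{n-1} = s_{n-1} ⋯ s_i` with `3 ≤ i ≤ n-1` and
`aₙ = sₙ ⋯ s_{i'}` with `3 ≤ i' ≤ n`, the element `sₙ·(a_{n-1} aₙ)` lies in
`Span(Λ_{n-1} Λₙ)`. -/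
theorem sn_mul_sdesc_sdesc_mem_span (e n : ℕ) (he : 1 ≤ e) (hn : 4 ≤ n)
    (i : ℕ) (h3i : 3 ≤ i) (hi : i ≤ n - 1)
    (i' : ℕ) (h3i' : 3 ≤ i') (hi' : i' ≤ n) :
    sH e n n * (sDescH e n (n - 1) i * sDescH e n n i') ∈
      Submodule.span R0 (LamH e n (n - 1) * LamH e n n) := by
  obtain ⟨p, rfl⟩ : ∃ p, n = p + 1 := ⟨n - 1, by omega⟩
  simp only [Nat.add_sub_cancel] at hi ⊢
  rw [← mul_assoc, ← sDescH_succ e (p+1) p i (by omega)]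
  rcases Nat.lt_or_ge i i' with h | h
  · obtain ⟨k, rfl⟩ : ∃ k, i' = k + 1 := ⟨i' - 1, by omega⟩
    rw [sDescH_shift_prod e (p+1) (p+1) i k p h3i (by omega) (by omega) le_rfl le_rfl]
    exact desc_mul_mem _ _ _ _ _ (by omega) (by omega) (by omega) (by omega)
  · obtain ⟨l, rfl⟩ : ∃ l, i = l + 1 := ⟨i - 1, by omega⟩
    have hc : Commute (sDescH e (p+1) (p+1) (l+1+1)) (sDescH e (p+1) l i') :=
      comm_sDescH _ _ _ _ _ fun j _ _ =>
        (comm_sDescH _ _ _ _ _ fun j' _ _ => sH_comm _ _ _ _ (by omega)).symm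
    have key : sDescH e (p+1) (p+1) (l+1) * sDescH e (p+1) (p+1) i' =
        aP • (sDescH e (p+1) p (l+1) * sDescH e (p+1) (p+1) i') +
          sDescH e (p+1) p i' * sDescH e (p+1) (p+1) (l+1+1) := by
      rw [sDescH_split e (p+1) (p+1) i' (l+1) (by omega) (by omega), ← mul_assoc,
        sDescH_shift_prod e (p+1) (p+1) (l+1) (l+1) p h3i le_rfl hi le_rfl le_rfl,
        sDescH_succ e (p+1) l i' h,
        sDescH_split e (p+1) (p+1) (l+1) (l+1) (by omega) (by omega), sDescH_self,
        sDescH_split e (p+1) p i' l h (by omega)]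
      have hq := sH_sq e (p+1) (l+1) h3i (by omega)
      calc _ = sDescH e (p+1) p (l+1) * (sDescH e (p+1) (p+1) (l+1+1) *
                ((sH e (p+1) (l+1) * sH e (p+1) (l+1)) * sDescH e (p+1) l i')) := by
              simp only [mul_assoc]
        _ = _ := by
              rw [hq, add_mul, one_mul, mul_add, mul_add, hc.eq, smul_mul_assoc,
                mul_smul_comm, mul_smul_comm, mul_assoc]
    rw [key]
    exact Submodule.add_mem _
      (Submodule.smul_mem _ _ (desc_mul_mem _ _ _ _ _ h3i hi h3i' hi'))
      (desc_mul_mem _ _ _ _ _ h3i' (by omega) (by omega) (by omega))
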